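/- arXiv:2203.03095 — 4 statements merged into one kernel-verified Lean document; each statement's English description precedes it below -/
import Mathlib

section
/- Let U ⊆ ℝ^m be open, let A₁, …, A_m : U → ℝ^{d×d} and Ω : U → ℝ^{d×d} be smooth matrix-valued functions, and let q_f, q_g : U → ℝ^d be smooth solutions of the Pfaffian system ∂_i q = A_i q (i = 1, …, m) on U. Then for every multi-index α = (α₁, …, α_m) ∈ ℤ_{≥0}^m and every z ∈ U, ∂^α (q_fᵀ Ω q_g)(z) = q_f(z)ᵀ (𝒟^α Ω)(z) q_g(z), where ∂^α = ∂₁^{α₁} ⋯ ∂_m^{α_m} and 𝒟^α = D₁^{α₁} ∘ D₂^{α₂} ∘ ⋯ ∘ D_m^{α_m}. -/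
open Matrix

/-- Partial derivative `∂_i` of a scalar function on `ℝ^m`. -/
noncomputable def pd {m : ℕ} (i : Fin m) (f : (Fin m → ℝ) → ℝ) : (Fin m → ℝ) → ℝ :=
  fun z => fderiv ℝ f z (Pi.single i 1)

/-- Iterated partial derivative `∂^α = ∂₁^{α₁} ⋯ ∂_m^{α_m}` for a multi-index `α`. -/
noncomputable def pdMulti {m : ℕ} (α : Fin m → ℕ) (f : (Fin m → ℝ) → ℝ) :
    (Fin m → ℝ) → ℝ :=
  ((List.finRange m).foldr (fun i F => (pd i)^[α i] ∘ F) id) f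

/-- Entrywise partial derivative `∂_i` of a matrix-valued function on `ℝ^m`. -/
noncomputable def pdM {m d : ℕ} (i : Fin m) (M : (Fin m → ℝ) → Matrix (Fin d) (Fin d) ℝ) :
    (Fin m → ℝ) → Matrix (Fin d) (Fin d) ℝ :=
  fun z => Matrix.of fun k l => fderiv ℝ (fun y => M y k l) z (Pi.single i 1)

/-- The mapping `D_i Ω := A_iᵀ Ω + Ω A_i + ∂_i Ω`. -/
noncomputable def Dop {m d : ℕ} (A : Fin m → (Fin m → ℝ) → Matrix (Fin d) (Fin d) ℝ)
    (i : Fin m) (Ω : (Fin m → ℝ) → Matrix (Fin d) (Fin d) ℝ) :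
    (Fin m → ℝ) → Matrix (Fin d) (Fin d) ℝ :=
  fun z => (A i z)ᵀ * Ω z + Ω z * A i z + pdM i Ω z

/-- `𝒟^α Ω = D₁^{α₁} ∘ D₂^{α₂} ∘ ⋯ ∘ D_m^{α_m}` applied to `Ω`, for a multi-index `α`. -/
noncomputable def DopMulti {m d : ℕ} (A : Fin m → (Fin m → ℝ) → Matrix (Fin d) (Fin d) ℝ)
    (α : Fin m → ℕ) (Ω : (Fin m → ℝ) → Matrix (Fin d) (Fin d) ℝ) :
    (Fin m → ℝ) → Matrix (Fin d) (Fin d) ℝ :=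
  ((List.finRange m).foldr (fun i F => (Dop A i)^[α i] ∘ F) id) Ω

/-- Leibniz rule for the partial derivatives of `uᵀ M v`. -/
theorem pd_dotProduct_mulVec {m d : ℕ} (i : Fin m) {u v : (Fin m → ℝ) → (Fin d → ℝ)}
    {M : (Fin m → ℝ) → Matrix (Fin d) (Fin d) ℝ} {z : Fin m → ℝ}
    (hu : DifferentiableAt ℝ u z) (hv : DifferentiableAt ℝ v z)
    (hM : ∀ k l, DifferentiableAt ℝ (fun y => M y k l) z) :
    pd i (fun y => u y ⬝ᵥ (M y *ᵥ v y)) z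
      = fderiv ℝ u z (Pi.single i 1) ⬝ᵥ (M z *ᵥ v z) + u z ⬝ᵥ (pdM i M z *ᵥ v z)
        + u z ⬝ᵥ (M z *ᵥ fderiv ℝ v z (Pi.single i 1)) := by
  have hu' := hasFDerivAt_pi'.1 hu.hasFDerivAt
  have hv' := hasFDerivAt_pi'.1 hv.hasFDerivAt
  have key : HasFDerivAt (fun y => u y ⬝ᵥ (M y *ᵥ v y)) _ z :=
    HasFDerivAt.fun_sum (u := Finset.univ) fun k _ =>
      (hu' k).mul (HasFDerivAt.fun_sum (u := Finset.univ) fun l _ =>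
        (hM k l).hasFDerivAt.mul (hv' l))
  rw [pd, key.fderiv]
  simp only [dotProduct, mulVec, pdM, of_apply, ← Finset.sum_add_distrib,
    _root_.sum_apply, _root_.add_apply,
    _root_.smul_apply, ContinuousLinearMap.comp_apply,
    ContinuousLinearMap.proj_apply, smul_eq_mul]
  refine Finset.sum_congr rfl fun k _ => ?_
  rw [add_assoc, ← mul_add, ← Finset.sum_add_distrib, add_comm]
  congr 1
  · ring
  · congr 1
    exact Finset.sum_congr rfl fun l _ => by ring

/-- `D_i` preserves smoothness. -/
theorem contDiffOn_Dop {m d : ℕ} {U : Set (Fin m → ℝ)} (hU : IsOpen U)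
    {A : Fin m → (Fin m → ℝ) → Matrix (Fin d) (Fin d) ℝ}
    {M : (Fin m → ℝ) → Matrix (Fin d) (Fin d) ℝ}
    (hA : ∀ i k l, ContDiffOn ℝ (⊤ : ℕ∞) (fun z => A i z k l) U)
    (hM : ∀ k l, ContDiffOn ℝ (⊤ : ℕ∞) (fun z => M z k l) U) (i : Fin m) (k l : Fin d) :
    ContDiffOn ℝ (⊤ : ℕ∞) (fun z => Dop A i M z k l) U := by
  simp only [Dop, pdM, Matrix.add_apply, mul_apply, transpose_apply, of_apply]
  refine ((ContDiffOn.sum fun j _ => (hA i j k).mul (hM j l)).add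
    (ContDiffOn.sum fun j _ => (hM k j).mul (hA i j l))).add ?_
  exact ((hM k l).fderiv_of_isOpen hU (by simp)).clm_apply contDiffOn_const

/-- If `f = q_fᵀ M q_g` on `U`, then `∂_i f = q_fᵀ (D_i M) q_g` on `U`. -/
theorem pd_eq_dotProduct_Dop {m d : ℕ} {U : Set (Fin m → ℝ)} (hU : IsOpen U)
    {A : Fin m → (Fin m → ℝ) → Matrix (Fin d) (Fin d) ℝ}
    {M : (Fin m → ℝ) → Matrix (Fin d) (Fin d) ℝ}
    (hM : ∀ k l, DifferentiableOn ℝ (fun z => M z k l) U)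
    {qf qg : (Fin m → ℝ) → (Fin d → ℝ)}
    (hqf : DifferentiableOn ℝ qf U) (hqg : DifferentiableOn ℝ qg U)
    (hqf' : ∀ z ∈ U, ∀ i, fderiv ℝ qf z (Pi.single i 1) = A i z *ᵥ qf z)
    (hqg' : ∀ z ∈ U, ∀ i, fderiv ℝ qg z (Pi.single i 1) = A i z *ᵥ qg z)
    {f : (Fin m → ℝ) → ℝ} (hf : Set.EqOn f (fun y => qf y ⬝ᵥ (M y *ᵥ qg y)) U) (i : Fin m) :
    Set.EqOn (pd i f) (fun y => qf y ⬝ᵥ (Dop A i M y *ᵥ qg y)) U := by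
  intro z hz
  have hn := hU.mem_nhds hz
  have hfz : pd i f z = pd i (fun y => qf y ⬝ᵥ (M y *ᵥ qg y)) z := by
    rw [pd, pd, (hf.eventuallyEq_of_mem hn).fderiv_eq]
  rw [hfz, pd_dotProduct_mulVec i (hqf.differentiableAt hn) (hqg.differentiableAt hn)
    fun k l => (hM k l).differentiableAt hn, hqf' z hz, hqg' z hz]
  simp only [Dop, add_mulVec, dotProduct_add, ← mulVec_mulVec]
  rw [dotProduct_mulVec (qf z) (A i z)ᵀ, vecMul_transpose]
  ring

/-- For smooth solutions `q_f, q_g` of the Pfaffian system `∂_i q = A_i q`,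
`∂^α (q_fᵀ Ω q_g) = q_fᵀ (𝒟^α Ω) q_g` on `U` for every multi-index `α`. -/
theorem stmt5 {m d : ℕ}
    (U : Set (Fin m → ℝ)) (hU : IsOpen U)
    (A : Fin m → (Fin m → ℝ) → Matrix (Fin d) (Fin d) ℝ)
    (Ω : (Fin m → ℝ) → Matrix (Fin d) (Fin d) ℝ)
    (hA : ∀ i k l, ContDiffOn ℝ (⊤ : ℕ∞) (fun z => A i z k l) U)
    (hΩ : ∀ k l, ContDiffOn ℝ (⊤ : ℕ∞) (fun z => Ω z k l) U)
    (qf qg : (Fin m → ℝ) → (Fin d → ℝ))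
    (hqf : ContDiffOn ℝ (⊤ : ℕ∞) qf U) (hqg : ContDiffOn ℝ (⊤ : ℕ∞) qg U)
    (hqf' : ∀ z ∈ U, ∀ i, fderiv ℝ qf z (Pi.single i 1) = A i z *ᵥ qf z)
    (hqg' : ∀ z ∈ U, ∀ i, fderiv ℝ qg z (Pi.single i 1) = A i z *ᵥ qg z) :
    ∀ α : Fin m → ℕ, ∀ z ∈ U,
      pdMulti α (fun y => qf y ⬝ᵥ (Ω y *ᵥ qg y)) z
        = qf z ⬝ᵥ (DopMulti A α Ω z *ᵥ qg z) := by
  let R (f : (Fin m → ℝ) → ℝ) (M : (Fin m → ℝ) → Matrix (Fin d) (Fin d) ℝ) : Prop :=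
    (∀ k l, ContDiffOn ℝ (⊤ : ℕ∞) (fun z => M z k l) U) ∧
      Set.EqOn f (fun y => qf y ⬝ᵥ (M y *ᵥ qg y)) U
  have step (i : Fin m) {f M} (h : R f M) : R (pd i f) (Dop A i M) :=
    ⟨contDiffOn_Dop hU hA h.1 i,
      pd_eq_dotProduct_Dop hU (fun k l => (h.1 k l).differentiableOn (by simp))
        (hqf.differentiableOn (by simp)) (hqg.differentiableOn (by simp)) hqf' hqg' h.2 i⟩
  have iter (i : Fin m) (n : ℕ) {f M} (h : R f M) : R ((pd i)^[n] f) ((Dop A i)^[n] M) := by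
    induction n with
    | zero => exact h
    | succ n ih =>
      rw [Function.iterate_succ_apply', Function.iterate_succ_apply']
      exact step i ih
  intro α z hz
  have fold (L : List (Fin m)) {f M} (h : R f M) :
      R (L.foldr (fun i F => (pd i)^[α i] ∘ F) id f)
        (L.foldr (fun i F => (Dop A i)^[α i] ∘ F) id M) := by
    induction L with
    | nil => exact h
    | cons i L ih => exact iter i (α i) ih
  exact (fold (List.finRange m) ⟨hΩ, fun _ _ => rfl⟩).2 hz
end

section
/- Let U ⊆ ℝ^m be open, let A₁, …, A_m : U → ℝ^{d×d} be continuously differentiable matrix-valued functions satisfying the integrability condition ∂_j A_i + A_i A_j = ∂_i A_j + A_j A_i on U for all 1 ≤ i < j ≤ m, and let Ω : U → ℝ^{d×d} be twice continuously differentiable. Then D_i (D_j Ω) = D_j (D_i Ω) on U for all i, j ∈ {1, …, m}. -/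
open Matrix

section pdM

variable {m d : ℕ} {M N : (Fin m → ℝ) → Matrix (Fin d) (Fin d) ℝ} {z : Fin m → ℝ}

theorem pdM_add (i : Fin m)
    (hM : ∀ k l, DifferentiableAt ℝ (fun y => M y k l) z)
    (hN : ∀ k l, DifferentiableAt ℝ (fun y => N y k l) z) :
    pdM i (fun y => M y + N y) z = pdM i M z + pdM i N z := by
  ext k l
  simp [pdM, fderiv_fun_add (hM k l) (hN k l)]

theorem pdM_mul (i : Fin m)
    (hM : ∀ k l, DifferentiableAt ℝ (fun y => M y k l) z)
    (hN : ∀ k l, DifferentiableAt ℝ (fun y => N y k l) z) :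
    pdM i (fun y => M y * N y) z = pdM i M z * N z + M z * pdM i N z := by
  ext k l
  simp only [pdM, Matrix.mul_apply, Matrix.add_apply, Matrix.of_apply]
  rw [fderiv_fun_sum fun a _ => (hM k a).fun_mul (hN a l), _root_.sum_apply,
    ← Finset.sum_add_distrib]
  refine Finset.sum_congr rfl fun a _ => ?_
  rw [fderiv_fun_mul (hM k a) (hN a l)]
  simp only [_root_.add_apply, _root_.smul_apply, smul_eq_mul]
  ring

theorem pdM_transpose (i : Fin m) : pdM i (fun y => (M y)ᵀ) z = (pdM i M z)ᵀ := rfl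

theorem differentiableAt_mul_apply
    (hM : ∀ k l, DifferentiableAt ℝ (fun y => M y k l) z)
    (hN : ∀ k l, DifferentiableAt ℝ (fun y => N y k l) z) (k l : Fin d) :
    DifferentiableAt ℝ (fun y => (M y * N y) k l) z := by
  simp only [Matrix.mul_apply]
  exact DifferentiableAt.fun_sum fun a _ => (hM k a).mul (hN a l)

theorem differentiableAt_pdM_apply (hM : ∀ k l, ContDiffAt ℝ 2 (fun y => M y k l) z)
    (i : Fin m) (k l : Fin d) : DifferentiableAt ℝ (fun y => pdM i M y k l) z := by
  have h : DifferentiableAt ℝ (fderiv ℝ fun y => M y k l) z :=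
    ((hM k l).fderiv_right (m := 1) (by norm_num)).differentiableAt one_ne_zero
  exact h.clm_apply (differentiableAt_const _)

theorem pdM_comm (hM : ∀ k l, ContDiffAt ℝ 2 (fun y => M y k l) z) (i j : Fin m) :
    pdM i (pdM j M) z = pdM j (pdM i M) z := by
  ext k l
  have h : DifferentiableAt ℝ (fderiv ℝ fun y => M y k l) z :=
    ((hM k l).fderiv_right (m := 1) (by norm_num)).differentiableAt one_ne_zero
  have key (v w : Fin m → ℝ) : fderiv ℝ (fun y => fderiv ℝ (fun x => M x k l) y v) z w =
      fderiv ℝ (fderiv ℝ fun y => M y k l) z w v := by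
    rw [fderiv_clm_apply h (differentiableAt_const _)]
    simp
  simp only [pdM, Matrix.of_apply, key]
  exact ((hM k l).isSymmSndFDerivAt (by simp)).eq _ _

/-- The product-rule expansion of `D_i (D_j Ω)`. -/
theorem Dop_Dop {A : Fin m → (Fin m → ℝ) → Matrix (Fin d) (Fin d) ℝ}
    {Ω : (Fin m → ℝ) → Matrix (Fin d) (Fin d) ℝ}
    (hA : ∀ i k l, DifferentiableAt ℝ (fun y => A i y k l) z)
    (hΩ : ∀ k l, ContDiffAt ℝ 2 (fun y => Ω y k l) z) (i j : Fin m) :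
    Dop A i (Dop A j Ω) z =
      (pdM i (A j) z + A j z * A i z)ᵀ * Ω z + Ω z * (pdM i (A j) z + A j z * A i z)
      + ((A i z)ᵀ * Ω z * A j z + (A j z)ᵀ * Ω z * A i z)
      + ((A i z)ᵀ * pdM j Ω z + (A j z)ᵀ * pdM i Ω z)
      + (pdM j Ω z * A i z + pdM i Ω z * A j z) + pdM i (pdM j Ω) z := by
  have hΩ' (k l) : DifferentiableAt ℝ (fun y => Ω y k l) z :=
    (hΩ k l).differentiableAt two_ne_zero
  have hT (k l) : DifferentiableAt ℝ (fun y => (A j y)ᵀ k l) z := hA j l k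
  have h₁ := differentiableAt_mul_apply hT hΩ'
  have h₂ := differentiableAt_mul_apply hΩ' (hA j)
  have hD : pdM i (Dop A j Ω) z = (pdM i (A j) z)ᵀ * Ω z + (A j z)ᵀ * pdM i Ω z
      + (pdM i Ω z * A j z + Ω z * pdM i (A j) z) + pdM i (pdM j Ω) z := by
    have h₃ (k l) : DifferentiableAt ℝ
        (fun y => ((A j y)ᵀ * Ω y + Ω y * A j y) k l) z := (h₁ k l).fun_add (h₂ k l)
    unfold Dop
    rw [pdM_add i h₃ (differentiableAt_pdM_apply hΩ j),
      pdM_add i h₁ h₂, pdM_mul i hT hΩ', pdM_mul i hΩ' (hA j), pdM_transpose]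
  rw [Dop, hD, Dop, Matrix.transpose_add, Matrix.transpose_mul]
  noncomm_ring

end pdM

/-- Under the integrability condition `∂_j A_i + A_i A_j = ∂_i A_j + A_j A_i`,
the mappings `D_i` and `D_j` commute: `D_i (D_j Ω) = D_j (D_i Ω)` on `U`. -/
theorem stmt7 {m d : ℕ}
    (U : Set (Fin m → ℝ)) (hU : IsOpen U)
    (A : Fin m → (Fin m → ℝ) → Matrix (Fin d) (Fin d) ℝ)
    (hA : ∀ i k l, ContDiffOn ℝ 1 (fun z => A i z k l) U)
    (hint : ∀ i j : Fin m, i < j → ∀ z ∈ U,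
      pdM j (A i) z + A i z * A j z = pdM i (A j) z + A j z * A i z)
    (Ω : (Fin m → ℝ) → Matrix (Fin d) (Fin d) ℝ)
    (hΩ : ∀ k l, ContDiffOn ℝ 2 (fun z => Ω z k l) U) :
    ∀ i j : Fin m, ∀ z ∈ U, Dop A i (Dop A j Ω) z = Dop A j (Dop A i Ω) z := by
  intro i j z hz
  have hUz := hU.mem_nhds hz
  have hA' (i k l) : DifferentiableAt ℝ (fun y => A i y k l) z :=
    ((hA i k l).contDiffAt hUz).differentiableAt one_ne_zero
  have hΩ' (k l) : ContDiffAt ℝ 2 (fun y => Ω y k l) z := (hΩ k l).contDiffAt hUz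
  have hij : pdM i (A j) z + A j z * A i z = pdM j (A i) z + A i z * A j z := by
    rcases lt_trichotomy i j with h | rfl | h
    · exact (hint i j h z hz).symm
    · rfl
    · exact hint j i h z hz
  rw [Dop_Dop hA' hΩ', Dop_Dop hA' hΩ', hij, pdM_comm hΩ' i j,
    add_comm ((A i z)ᵀ * Ω z * A j z), add_comm ((A i z)ᵀ * pdM j Ω z),
    add_comm (pdM j Ω z * A i z)]
end

section
/- Let U ⊆ ℝ^m be open and connected, let A₁, …, A_m : U → ℝ^{s×s} be continuous matrix-valued functions, and let q₁, q₂ : U → ℝ^s be continuously differentiable solutions of the Pfaffian system ∂_i q = A_i q (i = 1, …, m) on U. If q₁(z̄) = q₂(z̄) for some z̄ ∈ U, then q₁ = q₂ on all of U. -/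
open Matrix

theorem eqOn_zero_of_norm_fderiv_le_of_convex {E F : Type*}
    [NormedAddCommGroup E] [NormedSpace ℝ E] [NormedAddCommGroup F] [NormedSpace ℝ F]
    {B : Set E} (hB : Convex ℝ B) {f : E → F} {K : ℝ}
    (hf : ∀ z ∈ B, DifferentiableAt ℝ f z)
    (hK : ∀ z ∈ B, ‖fderiv ℝ f z‖ ≤ K * ‖f z‖)
    {y : E} (hy : y ∈ B) (hfy : f y = 0) {x : E} (hx : x ∈ B) : f x = 0 := by
  have hmem : ∀ t ∈ Set.Icc (0 : ℝ) 1, AffineMap.lineMap y x t ∈ B :=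
    fun t ht => hB.lineMap_mem hy hx ht
  have hd : ∀ t ∈ Set.Icc (0 : ℝ) 1,
      HasDerivAt (fun t : ℝ => f (AffineMap.lineMap y x t))
        (fderiv ℝ f (AffineMap.lineMap y x t) (x - y)) t :=
    fun t ht => (hf _ (hmem t ht)).hasFDerivAt.comp_hasDerivAt t AffineMap.hasDerivAt_lineMap
  have h := eq_zero_of_abs_deriv_le_mul_abs_self_of_eq_zero_right
    (K := K * ‖x - y‖) (a := 0) (b := 1)
    (fun t ht => (hd t ht).continuousAt.continuousWithinAt)
    (fun t ht => (hd t (Set.Ico_subset_Icc_self ht)).hasDerivWithinAt)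
    (by simpa using hfy)
    (fun t ht => by
      have h1 := hK _ (hmem t (Set.Ico_subset_Icc_self ht))
      calc _ ≤ ‖fderiv ℝ f (AffineMap.lineMap y x t)‖ * ‖x - y‖ :=
            ContinuousLinearMap.le_opNorm _ _
        _ ≤ K * ‖f (AffineMap.lineMap y x t)‖ * ‖x - y‖ := by gcongr
        _ = _ := by ring)
    1 (by simp)
  simpa using h

theorem IsPreconnected.eqOn_zero_of_norm_fderiv_le {E F : Type*}
    [NormedAddCommGroup E] [NormedSpace ℝ E] [NormedAddCommGroup F] [NormedSpace ℝ F]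
    {U : Set E} (hUconn : IsPreconnected U) (hU : IsOpen U) {f : E → F}
    (hf : DifferentiableOn ℝ f U)
    (hK : ∀ z ∈ U, ∃ K : ℝ, ∀ᶠ y in nhds z, ‖fderiv ℝ f y‖ ≤ K * ‖f y‖)
    {z₀ : E} (hz₀ : z₀ ∈ U) (hfz₀ : f z₀ = 0) : Set.EqOn f 0 U := by
  have key : ∀ z ∈ U, z ∈ closure {y | f y = 0} → z ∈ interior {y | f y = 0} := by
    intro z hz hzc
    obtain ⟨K, hKz⟩ := hK z hz
    obtain ⟨r, hr, hball⟩ := Metric.eventually_nhds_iff_ball.mp (hKz.and (hU.mem_nhds hz))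
    obtain ⟨y, hy, hyz⟩ := mem_closure_iff_nhds.mp hzc _ (Metric.ball_mem_nhds z hr)
    refine mem_interior.mpr ⟨Metric.ball z r, fun x hx => ?_, Metric.isOpen_ball,
      Metric.mem_ball_self hr⟩
    exact eqOn_zero_of_norm_fderiv_le_of_convex (convex_ball z r)
      (fun w hw => (hf w (hball w hw).2).differentiableAt (hU.mem_nhds (hball w hw).2))
      (fun w hw => (hball w hw).1) hy hyz hx
  have hsub : U ⊆ interior {y | f y = 0} :=
    hUconn.subset_of_closure_inter_subset isOpen_interior
      ⟨z₀, hz₀, key z₀ hz₀ (subset_closure hfz₀)⟩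
      (fun z hz => key z hz.2 (closure_mono interior_subset hz.1))
  exact hsub.trans interior_subset

theorem Matrix.norm_mulVec_le_sum_abs {k l : Type*} [Fintype k] [Fintype l]
    (M : Matrix k l ℝ) (v : l → ℝ) : ‖M *ᵥ v‖ ≤ (∑ a, ∑ b, |M a b|) * ‖v‖ := by
  refine (pi_norm_le_iff_of_nonneg (by positivity)).mpr fun a => ?_
  calc ‖(M *ᵥ v) a‖ ≤ ∑ b, ‖M a b * v b‖ := norm_sum_le _ _
    _ ≤ ∑ b, |M a b| * ‖v‖ := by
        refine Finset.sum_le_sum fun b _ => ?_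
        rw [norm_mul, Real.norm_eq_abs]
        gcongr
        exact norm_le_pi_norm v b
    _ = (∑ b, |M a b|) * ‖v‖ := by rw [Finset.sum_mul]
    _ ≤ _ := by
        gcongr
        exact Finset.single_le_sum (f := fun a => ∑ b, |M a b|)
          (fun _ _ => by positivity) (Finset.mem_univ a)

theorem ContinuousLinearMap.opNorm_le_sum_norm_single {ι F : Type*} [Fintype ι] [DecidableEq ι]
    [NormedAddCommGroup F] [NormedSpace ℝ F] (L : (ι → ℝ) →L[ℝ] F) :
    ‖L‖ ≤ ∑ i, ‖L (Pi.single i 1)‖ := by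
  refine L.opNorm_le_bound (by positivity) fun v => ?_
  have hv : L v = ∑ i, v i • L (Pi.single i 1) := by
    conv_lhs => rw [pi_eq_sum_univ' v]
    simp only [map_sum, map_smul]
  rw [hv, Finset.sum_mul]
  refine norm_sum_le_of_le _ fun i _ => ?_
  rw [norm_smul, mul_comm]
  gcongr
  exact norm_le_pi_norm v i

/-- Two continuously differentiable solutions of a Pfaffian system `∂_i q = A_i q`
(with continuous coefficient matrices) on an open connected set that agree at one
point agree everywhere on the set. -/
theorem stmt8 {m s : ℕ}
    (U : Set (Fin m → ℝ)) (hU : IsOpen U) (hUconn : IsConnected U)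
    (A : Fin m → (Fin m → ℝ) → Matrix (Fin s) (Fin s) ℝ)
    (hA : ∀ i k l, ContinuousOn (fun z => A i z k l) U)
    (q₁ q₂ : (Fin m → ℝ) → (Fin s → ℝ))
    (hq₁ : ContDiffOn ℝ 1 q₁ U) (hq₂ : ContDiffOn ℝ 1 q₂ U)
    (hq₁' : ∀ z ∈ U, ∀ i, fderiv ℝ q₁ z (Pi.single i 1) = A i z *ᵥ q₁ z)
    (hq₂' : ∀ z ∈ U, ∀ i, fderiv ℝ q₂ z (Pi.single i 1) = A i z *ᵥ q₂ z)
    (zbar : Fin m → ℝ) (hzbar : zbar ∈ U) (heq : q₁ zbar = q₂ zbar) :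
    Set.EqOn q₁ q₂ U := by
  have hd₁ := hq₁.differentiableOn one_ne_zero
  have hd₂ := hq₂.differentiableOn one_ne_zero
  have h0 : Set.EqOn (q₁ - q₂) 0 U := by
    refine hUconn.isPreconnected.eqOn_zero_of_norm_fderiv_le hU (hd₁.sub hd₂) (fun z hz => ?_)
      hzbar (by simp [heq])
    have hc : ContinuousOn (fun y => ∑ i, ∑ k, ∑ l, |A i y k l|) U :=
      continuousOn_finsetSum _ fun i _ => continuousOn_finsetSum _ fun k _ =>
        continuousOn_finsetSum _ fun l _ => (hA i k l).abs
    refine ⟨∑ i, ∑ k, ∑ l, |A i z k l| + 1, ?_⟩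
    filter_upwards [(hc.continuousAt (hU.mem_nhds hz)).eventually_lt_const (lt_add_one _),
      hU.mem_nhds hz] with y hy hyU
    refine (ContinuousLinearMap.opNorm_le_sum_norm_single _).trans ?_
    calc ∑ i, ‖fderiv ℝ (q₁ - q₂) y (Pi.single i 1)‖
        = ∑ i, ‖A i y *ᵥ (q₁ - q₂) y‖ := by
          refine Finset.sum_congr rfl fun i _ => ?_
          rw [fderiv_sub (hd₁.differentiableAt (hU.mem_nhds hyU))
            (hd₂.differentiableAt (hU.mem_nhds hyU)), Pi.sub_apply, Matrix.mulVec_sub,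
            ← hq₁' y hyU i, ← hq₂' y hyU i]
          rfl
      _ ≤ ∑ i, (∑ k, ∑ l, |A i y k l|) * ‖(q₁ - q₂) y‖ :=
          Finset.sum_le_sum fun i _ => Matrix.norm_mulVec_le_sum_abs _ _
      _ = (∑ i, ∑ k, ∑ l, |A i y k l|) * ‖(q₁ - q₂) y‖ := by rw [Finset.sum_mul]
      _ ≤ _ := by gcongr
  exact fun z hz => sub_eq_zero.mp (h0 hz)
end

section
/- Let U ⊆ ℝ^{2n} be open and connected, let A₁, …, A_{2n} : U → ℝ^{d×d} and Ω : U → ℝ^{d×d} be real-analytic matrix-valued functions, and let q_k, q_l : U → ℝ^d be real-analytic solutions of the Pfaffian system ∂_i q = A_i q (i = 1, …, 2n) on U. Fix z̄ ∈ U. Then q_k(z)ᵀ Ω(z) q_l(z) = 0 for all z ∈ U if and only if q_k(z̄)ᵀ (𝒟^α Ω)(z̄) q_l(z̄) = 0 for every multi-index α ∈ ℤ_{≥0}^{2n}. -/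
open Matrix

section PartialDerivatives

variable {m : ℕ} {U : Set (Fin m → ℝ)} {f g : (Fin m → ℝ) → ℝ}

/-- `pdMulti` with the composition running over an arbitrary list of coordinates. -/
noncomputable def pdList {m : ℕ} (L : List (Fin m)) (α : Fin m → ℕ) (f : (Fin m → ℝ) → ℝ) :
    (Fin m → ℝ) → ℝ :=
  (L.foldr (fun i F => (pd i)^[α i] ∘ F) id) f

theorem pdList_cons (j : Fin m) (L : List (Fin m)) (α : Fin m → ℕ) (f : (Fin m → ℝ) → ℝ) :
    pdList (j :: L) α f = (pd j)^[α j] (pdList L α f) := rfl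

theorem AnalyticOnNhd.pd (hf : AnalyticOnNhd ℝ f U) (i : Fin m) :
    AnalyticOnNhd ℝ (pd i f) U :=
  fun z hz => ((ContinuousLinearMap.apply ℝ ℝ (Pi.single i 1 : Fin m → ℝ)).analyticAt _).comp
    (hf.fderiv z hz)

theorem AnalyticOnNhd.iterate_pd (hf : AnalyticOnNhd ℝ f U) (i : Fin m) (a : ℕ) :
    AnalyticOnNhd ℝ ((_root_.pd i)^[a] f) U := by
  induction a with
  | zero => exact hf
  | succ a ih => rw [Function.iterate_succ_apply']; exact ih.pd i

theorem AnalyticOnNhd.pdList (hf : AnalyticOnNhd ℝ f U) (L : List (Fin m)) (α : Fin m → ℕ) :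
    AnalyticOnNhd ℝ (pdList L α f) U := by
  induction L with
  | nil => exact hf
  | cons j L ih => rw [pdList_cons]; exact ih.iterate_pd j _

theorem Set.EqOn.pd (hU : IsOpen U) (h : Set.EqOn f g U) (i : Fin m) :
    Set.EqOn (pd i f) (pd i g) U := fun z hz => by
  have : f =ᶠ[nhds z] g := Filter.eventuallyEq_of_mem (hU.mem_nhds hz) h
  simp only [_root_.pd, this.fderiv_eq]

theorem Set.EqOn.iterate_pd (hU : IsOpen U) (h : Set.EqOn f g U) (i : Fin m) (a : ℕ) :
    Set.EqOn ((_root_.pd i)^[a] f) ((_root_.pd i)^[a] g) U := by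
  induction a with
  | zero => exact h
  | succ a ih => simp only [Function.iterate_succ_apply']; exact ih.pd hU i

theorem Set.EqOn.pdList (hU : IsOpen U) (h : Set.EqOn f g U) (L : List (Fin m))
    (α : Fin m → ℕ) : Set.EqOn (pdList L α f) (pdList L α g) U := by
  induction L with
  | nil => exact h
  | cons j L ih => simp only [pdList_cons]; exact ih.iterate_pd hU j _

theorem pd_comm (hf : AnalyticOnNhd ℝ f U) (i j : Fin m) :
    Set.EqOn (pd i (pd j f)) (pd j (pd i f)) U := fun z hz => by
  have key : ∀ a b : Fin m, pd a (pd b f) z =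
      fderiv ℝ (fderiv ℝ f) z (Pi.single a 1) (Pi.single b 1) := fun a b => by
    change fderiv ℝ (fun y => fderiv ℝ f y (Pi.single b 1)) z (Pi.single a 1) = _
    rw [fderiv_clm_apply (hf.fderiv z hz).differentiableAt (differentiableAt_const _)]
    simp
  rw [key, key]
  exact ((hf z hz).contDiffAt.isSymmSndFDerivAt (n := 2) (by simp)).eq _ _

theorem pd_iterate_pd_comm (hU : IsOpen U) (hf : AnalyticOnNhd ℝ f U) (i j : Fin m) (a : ℕ) :
    Set.EqOn (pd i ((pd j)^[a] f)) ((pd j)^[a] (pd i f)) U := by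
  induction a with
  | zero => exact fun _ _ => rfl
  | succ a ih =>
    simp only [Function.iterate_succ_apply']
    exact (pd_comm (hf.iterate_pd j a) i j).trans (ih.pd hU j)

theorem pd_pdList_comm (hU : IsOpen U) (hf : AnalyticOnNhd ℝ f U) (i : Fin m)
    (L : List (Fin m)) (α : Fin m → ℕ) :
    Set.EqOn (pd i (pdList L α f)) (pdList L α (pd i f)) U := by
  induction L with
  | nil => exact fun _ _ => rfl
  | cons j L ih =>
    simp only [pdList_cons]
    exact (pd_iterate_pd_comm hU (hf.pdList L α) i j _).trans (ih.iterate_pd hU j _)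

theorem pdList_congr {L : List (Fin m)} {α β : Fin m → ℕ} (h : ∀ i ∈ L, α i = β i) :
    pdList L α f = pdList L β f := by
  induction L with
  | nil => rfl
  | cons j L ih =>
    rw [pdList_cons, pdList_cons, h j (by simp), ih fun i hi => h i (by simp [hi])]

theorem pd_pdList (hU : IsOpen U) (hf : AnalyticOnNhd ℝ f U) (i : Fin m) {L : List (Fin m)}
    (hL : L.Nodup) (hi : i ∈ L) (α : Fin m → ℕ) :
    Set.EqOn (pd i (pdList L α f)) (pdList L (α + Pi.single i 1) f) U := by
  induction L with
  | nil => simp at hi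
  | cons j L ih =>
    obtain ⟨hj, hL⟩ := List.nodup_cons.1 hL
    simp only [pdList_cons]
    by_cases hij : i = j
    · subst hij
      have : pdList L (α + Pi.single i 1) f = pdList L α f := pdList_congr fun k hk => by
        have : k ≠ i := fun h => hj (h ▸ hk)
        simp [this]
      rw [this, ← Function.iterate_succ_apply' (pd i)]
      simp [Set.eqOn_refl]
    · have hi' : i ∈ L := by simpa [hij] using hi
      have : (α + Pi.single i 1 : Fin m → ℕ) j = α j := by simp [Ne.symm hij]
      rw [this]
      exact (pd_iterate_pd_comm hU (hf.pdList L α) i j _).trans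
        ((ih hL hi').iterate_pd hU j _)

theorem pdMulti_pd (hU : IsOpen U) (hf : AnalyticOnNhd ℝ f U) (i : Fin m) (α : Fin m → ℕ) :
    Set.EqOn (pdMulti α (pd i f)) (pdMulti (α + Pi.single i 1) f) U :=
  (pd_pdList_comm hU hf i _ α).symm.trans
    (pd_pdList hU hf i (List.nodup_finRange m) (List.mem_finRange i) α)

theorem pdList_zero (L : List (Fin m)) (f : (Fin m → ℝ) → ℝ) : pdList L 0 f = f := by
  induction L with
  | nil => rfl
  | cons j L ih => rw [pdList_cons, ih]; rfl

/-- If all partial derivatives of an analytic function vanish at a point, so do its iterated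
Fréchet derivatives. -/
theorem iteratedFDeriv_eq_zero_of_pdMulti (hU : IsOpen U) {z : Fin m → ℝ} (hz : z ∈ U) (k : ℕ) :
    ∀ f : (Fin m → ℝ) → ℝ, AnalyticOnNhd ℝ f U → (∀ α, pdMulti α f z = 0) →
      iteratedFDeriv ℝ k f z = 0 := by
  induction k with
  | zero =>
    intro f _ h
    ext v
    have : pdMulti 0 f z = f z := congrFun (pdList_zero _ f) z
    simpa [this] using h 0
  | succ k ih =>
    intro f hf h
    ext v
    have hi : ∀ i : Fin m,
        iteratedFDeriv ℝ k (fderiv ℝ f) z (Fin.init v) (Pi.single i 1) = 0 := fun i => by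
      have h1 := ih (pd i f) (hf.pd i) fun α => by rw [pdMulti_pd hU hf i α hz, h]
      have h2 := (ContinuousLinearMap.apply ℝ ℝ
        (Pi.single i 1 : Fin m → ℝ)).iteratedFDeriv_comp_left (i := k) (n := k)
          (hf.fderiv z hz).contDiffAt le_rfl
      have h3 : (ContinuousLinearMap.apply ℝ ℝ (Pi.single i 1 : Fin m → ℝ)) ∘ fderiv ℝ f
          = pd i f := rfl
      rw [h3, h1] at h2
      simpa using (DFunLike.congr_fun h2 (Fin.init v)).symm
    rw [iteratedFDeriv_succ_apply_right, pi_eq_sum_univ' (v (Fin.last k)), map_sum]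
    simp only [map_smul, hi]
    simp

/-- An analytic function all of whose partial derivatives vanish at a point of a connected open
set vanishes on that set. -/
theorem AnalyticOnNhd.eqOn_zero_of_pdMulti (hf : AnalyticOnNhd ℝ f U) (hU : IsOpen U)
    (hUc : IsPreconnected U) {z : Fin m → ℝ} (hz : z ∈ U) (h : ∀ α, pdMulti α f z = 0) :
    Set.EqOn f 0 U := by
  refine hf.eqOn_zero_of_preconnected_of_eventuallyEq_zero hUc hz ?_
  obtain ⟨p, r, hp⟩ := hf z hz
  have hp0 : ∀ (k : ℕ) (y : Fin m → ℝ), p k (fun _ => y) = 0 := fun k y => by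
    have := hp.factorial_smul y k
    rw [iteratedFDeriv_eq_zero_of_pdMulti hU hz k f hf h] at this
    simpa [Nat.factorial_ne_zero] using this
  filter_upwards [Metric.eball_mem_nhds z hp.r_pos] with y hy
  have := hp.hasSum_sub hy
  simp only [hp0] at this
  exact this.unique hasSum_zero

end PartialDerivatives

section Pfaffian

variable {m d : ℕ} {U : Set (Fin m → ℝ)}
  {A : Fin m → (Fin m → ℝ) → Matrix (Fin d) (Fin d) ℝ}
  {M : (Fin m → ℝ) → Matrix (Fin d) (Fin d) ℝ} {p q : (Fin m → ℝ) → (Fin d → ℝ)}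

theorem Dop_analyticOnNhd (hA : ∀ i k l, AnalyticOnNhd ℝ (fun z => A i z k l) U)
    (hM : ∀ k l, AnalyticOnNhd ℝ (fun z => M z k l) U) (i : Fin m) (k l : Fin d) :
    AnalyticOnNhd ℝ (fun z => Dop A i M z k l) U := by
  simp only [Dop, Matrix.add_apply, Matrix.mul_apply, Matrix.transpose_apply, pdM, Matrix.of_apply]
  refine ((Finset.analyticOnNhd_fun_sum _ fun j _ => ?_).add
    (Finset.analyticOnNhd_fun_sum _ fun j _ => ?_)).add ((hM k l).pd i)
  · exact (hA i j k).mul (hM j l)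
  · exact (hM k j).mul (hA i j l)

theorem dotProduct_mulVec_analyticOnNhd (hM : ∀ k l, AnalyticOnNhd ℝ (fun z => M z k l) U)
    (hp : AnalyticOnNhd ℝ p U) (hq : AnalyticOnNhd ℝ q U) :
    AnalyticOnNhd ℝ (fun z => p z ⬝ᵥ (M z *ᵥ q z)) U := by
  have hp' := analyticOnNhd_pi_iff.1 hp
  have hq' := analyticOnNhd_pi_iff.1 hq
  simp only [dotProduct, mulVec]
  exact Finset.analyticOnNhd_fun_sum _ fun k _ => (hp' k).mul
    (Finset.analyticOnNhd_fun_sum _ fun l _ => (hM k l).mul (hq' l))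

/-- Along solutions of the Pfaffian system, `∂_i (pᵀ M q) = pᵀ (D_i M) q`. -/
theorem pd_dotProduct_mulVec_s11 (hM : ∀ k l, AnalyticOnNhd ℝ (fun z => M z k l) U)
    (hp : AnalyticOnNhd ℝ p U) (hq : AnalyticOnNhd ℝ q U)
    (hp' : ∀ z ∈ U, ∀ i, fderiv ℝ p z (Pi.single i 1) = A i z *ᵥ p z)
    (hq' : ∀ z ∈ U, ∀ i, fderiv ℝ q z (Pi.single i 1) = A i z *ᵥ q z) (i : Fin m) :
    Set.EqOn (pd i fun z => p z ⬝ᵥ (M z *ᵥ q z))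
      (fun z => p z ⬝ᵥ (Dop A i M z *ᵥ q z)) U := fun z hz => by
  have dp := hasFDerivAt_pi'.1 (hp z hz).differentiableAt.hasFDerivAt
  have dq := hasFDerivAt_pi'.1 (hq z hz).differentiableAt.hasFDerivAt
  have dM := fun k l => (hM k l z hz).differentiableAt.hasFDerivAt
  have hd := HasFDerivAt.fun_sum (u := Finset.univ) fun k _ =>
    (dp k).fun_mul (HasFDerivAt.fun_sum (u := Finset.univ) fun l _ => (dM k l).fun_mul (dq l))
  have hval : pd i (fun z => p z ⬝ᵥ (M z *ᵥ q z)) z =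
      (A i z *ᵥ p z) ⬝ᵥ (M z *ᵥ q z) + p z ⬝ᵥ (pdM i M z *ᵥ q z)
        + p z ⬝ᵥ (M z *ᵥ (A i z *ᵥ q z)) := by
    rw [← hp' z hz i, ← hq' z hz i, pd]
    refine (DFunLike.congr_fun (HasFDerivAt.fderiv hd) _).trans ?_
    simp only [dotProduct, mulVec, pdM, Matrix.of_apply, _root_.sum_apply,
      _root_.add_apply, _root_.smul_apply, smul_eq_mul,
      ContinuousLinearMap.comp_apply, ContinuousLinearMap.proj_apply,
      ← Finset.sum_add_distrib]
    refine Finset.sum_congr rfl fun k _ => ?_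
    rw [Finset.sum_add_distrib]
    simp only [mul_comm (q z _)]
    ring
  rw [hval]
  simp only [Dop, Matrix.add_mulVec, dotProduct_add, ← Matrix.mulVec_mulVec]
  rw [Matrix.dotProduct_mulVec (p z) (A i z)ᵀ, Matrix.vecMul_transpose]
  ring

end Pfaffian

/-- For real-analytic data on an open connected `U ⊆ ℝ^{2n}` and real-analytic
solutions `q_k, q_l` of the Pfaffian system, `q_kᵀ Ω q_l` vanishes identically on
`U` iff all the quantities `q_k(zbar)ᵀ (𝒟^α Ω)(zbar) q_l(zbar)` vanish at a single
point `zbar ∈ U`. -/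
theorem stmt11 {n d : ℕ}
    (U : Set (Fin (2 * n) → ℝ)) (hU : IsOpen U) (hUconn : IsConnected U)
    (A : Fin (2 * n) → (Fin (2 * n) → ℝ) → Matrix (Fin d) (Fin d) ℝ)
    (Ω : (Fin (2 * n) → ℝ) → Matrix (Fin d) (Fin d) ℝ)
    (hA : ∀ i k l, AnalyticOnNhd ℝ (fun z => A i z k l) U)
    (hΩ : ∀ k l, AnalyticOnNhd ℝ (fun z => Ω z k l) U)
    (qk ql : (Fin (2 * n) → ℝ) → (Fin d → ℝ))
    (hqk : AnalyticOnNhd ℝ qk U) (hql : AnalyticOnNhd ℝ ql U)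
    (hqk' : ∀ z ∈ U, ∀ i, fderiv ℝ qk z (Pi.single i 1) = A i z *ᵥ qk z)
    (hql' : ∀ z ∈ U, ∀ i, fderiv ℝ ql z (Pi.single i 1) = A i z *ᵥ ql z)
    (zbar : Fin (2 * n) → ℝ) (hzbar : zbar ∈ U) :
    (∀ z ∈ U, qk z ⬝ᵥ (Ω z *ᵥ ql z) = 0) ↔
      (∀ α : Fin (2 * n) → ℕ, qk zbar ⬝ᵥ (DopMulti A α Ω zbar *ᵥ ql zbar) = 0) := by
  have hlist : ∀ (L : List (Fin (2 * n))) (α : Fin (2 * n) → ℕ),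
      (∀ k l, AnalyticOnNhd ℝ
        (fun z => (L.foldr (fun i F => (Dop A i)^[α i] ∘ F) id) Ω z k l) U) ∧
      Set.EqOn (pdList L α fun z => qk z ⬝ᵥ (Ω z *ᵥ ql z))
        (fun z => qk z ⬝ᵥ ((L.foldr (fun i F => (Dop A i)^[α i] ∘ F) id) Ω z *ᵥ ql z)) U := by
    intro L α
    induction L with
    | nil => exact ⟨hΩ, fun _ _ => rfl⟩
    | cons j L ih =>
      simp only [pdList_cons, List.foldr_cons, Function.comp_apply]
      generalize α j = a
      induction a with
      | zero => exact ih
      | succ a iha =>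
        simp only [Function.iterate_succ_apply']
        exact ⟨Dop_analyticOnNhd hA iha.1 j, (iha.2.pd hU j).trans
          (pd_dotProduct_mulVec_s11 iha.1 hqk hql hqk' hql' j)⟩
  have hmulti : ∀ α, pdMulti α (fun z => qk z ⬝ᵥ (Ω z *ᵥ ql z)) zbar =
      qk zbar ⬝ᵥ (DopMulti A α Ω zbar *ᵥ ql zbar) := fun α => (hlist _ α).2 hzbar
  constructor
  · intro h α
    have hzero : Set.EqOn (fun z => qk z ⬝ᵥ (Ω z *ᵥ ql z)) 0 U := h
    have h0 : ∀ L : List (Fin (2 * n)), pdList L α 0 = 0 := fun L => by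
      have hpd : ∀ i : Fin (2 * n), pd i 0 = 0 := fun i => by ext; simp [pd]
      induction L with
      | nil => rfl
      | cons j L ih => rw [pdList_cons, ih, Function.iterate_fixed (hpd j)]
    rw [← hmulti]
    exact (hzero.pdList hU _ α hzbar).trans (congrFun (h0 _) zbar)
  · intro h
    exact (dotProduct_mulVec_analyticOnNhd hΩ hqk hql).eqOn_zero_of_pdMulti hU
      hUconn.isPreconnected hzbar fun α => (hmulti α).trans (h α)
end
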